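/- Let h : Q → P be a contraction morphism (ι-map) of positive opetopes and q₁, q₂ ∈ Q − ker(h). Then q₁ <⁻ q₂ if and only if h(q₁) <⁻ h(q₂). -/

import Mathlib

/-- A positive hypergraph: graded faces with codomain functions `γ` and (total) domain
relations `δ`. -/
structure PreOpetope where
  P : ℕ → Type
  γ : ∀ k, P (k+1) → P k
  δ : ∀ k, P (k+1) → Set (P k)

namespace PreOpetope

/-- The lower order `<⁻` on `P (k+1)`: transitive closure of `γ a ∈ δ b`. -/
def ltm (O : PreOpetope) (k : ℕ) : O.P (k+1) → O.P (k+1) → Prop :=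
  Relation.TransGen (fun a b => O.γ k a ∈ O.δ k b)

/-- The lower order in every dimension (empty in dimension `0`). -/
def ltmAll (O : PreOpetope) : ∀ k, O.P k → O.P k → Prop
  | 0 => fun _ _ => False
  | (k+1) => O.ltm k

/-- The upper order `<⁺` on `P k`: transitive closure of
`∃ c, a ∈ δ c ∧ γ c = b`. -/
def ltp (O : PreOpetope) (k : ℕ) : O.P k → O.P k → Prop :=
  Relation.TransGen (fun a b => ∃ c : O.P (k+1), a ∈ O.δ k c ∧ O.γ k c = b)

/-- `O` is a positive opetope: a finite positive hypergraph satisfying globularity,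
strictness, disjointness and pencil linearity, with at most one maximal face
(`P_l − δ(P_{l+1})`) in every dimension. -/
structure IsOpetope (O : PreOpetope) : Prop where
  fin : ∀ k, Finite (O.P k)
  bounded : ∃ n, ∀ k, n < k → IsEmpty (O.P k)
  ne : Nonempty (O.P 0)
  pos : ∀ k (a : O.P (k+1)), (O.δ k a).Nonempty
  δzero : ∀ a : O.P 1, ∃! x, x ∈ O.δ 0 a
  glob_γ : ∀ k (a : O.P (k+2)),
    {x : O.P k | x = O.γ k (O.γ (k+1) a)} =
      {x | ∃ b ∈ O.δ (k+1) a, O.γ k b = x} \ {x | ∃ b ∈ O.δ (k+1) a, x ∈ O.δ k b}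
  glob_δ : ∀ k (a : O.P (k+2)),
    O.δ k (O.γ (k+1) a) =
      {x | ∃ b ∈ O.δ (k+1) a, x ∈ O.δ k b} \ {x | ∃ b ∈ O.δ (k+1) a, O.γ k b = x}
  strict : ∀ k (a : O.P k), ¬ O.ltp k a a
  strict0 : ∀ a b : O.P 0, a = b ∨ O.ltp 0 a b ∨ O.ltp 0 b a
  disj : ∀ k (a b : O.P (k+1)),
    ¬ ((O.ltm k a b ∨ O.ltm k b a) ∧ (O.ltp (k+1) a b ∨ O.ltp (k+1) b a))
  pencil_γ : ∀ k (a b : O.P (k+1)), O.γ k a = O.γ k b →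
    a = b ∨ O.ltp (k+1) a b ∨ O.ltp (k+1) b a
  pencil_δ : ∀ k (x : O.P k) (a b : O.P (k+1)), x ∈ O.δ k a → x ∈ O.δ k b →
    a = b ∨ O.ltp (k+1) a b ∨ O.ltp (k+1) b a
  size : ∀ k (a b : O.P k), (¬ ∃ c : O.P (k+1), a ∈ O.δ k c) →
    (¬ ∃ c : O.P (k+1), b ∈ O.δ k c) → a = b

end PreOpetope

namespace PreOpetope

/-- Iterated codomain `γ^(k)`: apply `γ` to a face of dimension `l` until the dimension
is at most `k`. -/
def γdown (O : PreOpetope) : ∀ (l : ℕ), O.P l → ℕ → Σ j, O.P j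
  | 0, p, _ => ⟨0, p⟩
  | (l+1), p, k => if l + 1 ≤ k then ⟨l+1, p⟩ else O.γdown l (O.γ l p) k

end PreOpetope

/-- A contraction morphism (`ι`-map) of positive hypergraphs `h : Q → P`: faces map to
faces of dimension at most their own, iterated codomains are preserved, and domains are
preserved in the graded sense, where `ker h` consists of the dimension-lowering
(collapsing) faces. -/
structure IsContraction (Q P : PreOpetope) (h : ∀ k, Q.P k → Σ j, P.P j) : Prop where
  dim_le : ∀ k (q : Q.P k), (h k q).1 ≤ k
  γ_pres : ∀ (l k : ℕ) (q : Q.P l),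
    h (Q.γdown l q k).1 (Q.γdown l q k).2 = P.γdown (h l q).1 (h l q).2 k
  δ_eq : ∀ k (q : Q.P (k+1)) (p : P.P (k+1)), h (k+1) q = ⟨k+1, p⟩ →
    Set.BijOn (fun x => h k x) {x | x ∈ Q.δ k q ∧ (h k x).1 = k}
      {y : Σ j, P.P j | ∃ y' ∈ P.δ k p, y = ⟨k, y'⟩}
  δ_drop : ∀ k (q : Q.P (k+1)), (h (k+1) q).1 = k →
    Set.BijOn (fun x => h k x) {x | x ∈ Q.δ k q ∧ (h k x).1 = k} {h (k+1) q}
  δ_low : ∀ k (q : Q.P (k+1)), (h (k+1) q).1 < k →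
    ∀ x ∈ Q.δ k q, (h k x).1 < k

namespace PreOpetope

/-- One step of the upper order along a face that is not a codomain. -/
def MinStep (O : PreOpetope) (k : ℕ) (x y : O.P k) : Prop :=
  ∃ c : O.P (k+1), (¬ ∃ α, O.γ (k+1) α = c) ∧ x ∈ O.δ k c ∧ O.γ k c = y

/-- Some iterated codomains of `a` and `b` (possibly `a` and `b` themselves) are comparable
in the lower order. -/
def LowerComparable (O : PreOpetope) : ∀ k, O.P k → O.P k → Prop
  | 0, _, _ => False
  | (k+1), a, b => O.ltm k a b ∨ O.ltm k b a ∨ LowerComparable O k (O.γ k a) (O.γ k b)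

theorem not_ltp_of_not_codomain {O : PreOpetope} {k : ℕ} {a c : O.P k}
    (hc : ¬ ∃ α, O.γ k α = c) : ¬ O.ltp k a c := by
  intro hac
  obtain ⟨b, -, α, -, hα⟩ := Relation.TransGen.tail'_iff.1 hac
  exact hc ⟨α, hα⟩

theorem ltp_of_transGen_minStep {O : PreOpetope} {k : ℕ} {a b : O.P k}
    (hab : Relation.TransGen (O.MinStep k) a b) : O.ltp k a b :=
  Relation.TransGen.mono (fun _ _ ⟨c, _, hc⟩ => ⟨c, hc⟩) _ _ hab

theorem ltp_γ_of_ltm {O : PreOpetope} {k : ℕ} {a b : O.P (k+1)} (hab : O.ltm k a b) :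
    O.ltp k (O.γ k a) (O.γ k b) :=
  Relation.TransGen.lift (O.γ k) (fun _ d hcd => ⟨d, hcd, rfl⟩) _ _ hab

namespace IsOpetope

theorem wellFounded_ltp {O : PreOpetope} (hO : O.IsOpetope) (k : ℕ) : WellFounded (O.ltp k) := by
  have := hO.fin k
  have : IsTrans (O.P k) (O.ltp k) := ⟨fun _ _ _ => Relation.TransGen.trans⟩
  have : Std.Irrefl (O.ltp k) := ⟨hO.strict k⟩
  exact Finite.wellFounded_of_trans_of_irrefl _

theorem wellFounded_swap_ltp {O : PreOpetope} (hO : O.IsOpetope)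
    (k : ℕ) : WellFounded (Function.swap (O.ltp k)) := by
  have := hO.fin k
  have : IsTrans (O.P k) (Function.swap (O.ltp k)) :=
    ⟨fun _ _ _ hab hbc => Relation.TransGen.trans hbc hab⟩
  have : Std.Irrefl (Function.swap (O.ltp k)) := ⟨hO.strict k⟩
  exact Finite.wellFounded_of_trans_of_irrefl _

theorem not_ltm_self {O : PreOpetope} (hO : O.IsOpetope) {k : ℕ} (a : O.P (k+1)) : ¬ O.ltm k a a :=
  fun ha => hO.strict k _ (ltp_γ_of_ltm ha)

theorem γ_eq_or_mem_δ {O : PreOpetope} (hO : O.IsOpetope)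
    {k : ℕ} {α : O.P (k+2)} {a : O.P (k+1)} (ha : a ∈ O.δ (k+1) α) :
    O.γ k a = O.γ k (O.γ (k+1) α) ∨ ∃ b ∈ O.δ (k+1) α, O.γ k a ∈ O.δ k b := by
  by_contra! hcon
  have hmem : O.γ k a ∈ {x : O.P k | x = O.γ k (O.γ (k+1) α)} := by
    rw [hO.glob_γ k α]
    exact ⟨⟨a, ha, rfl⟩, fun ⟨b, hb, hab⟩ => hcon.2 b hb hab⟩
  exact hcon.1 hmem

/-- If every domain face `a` of `α` is traversed by `r` from its domain to its codomain,
then so is the domain of `α`, ending in `γ γ α`. -/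
theorem transGen_of_mem_δδ {O : PreOpetope} (hO : O.IsOpetope)
    {k : ℕ} {α : O.P (k+2)} {r : O.P k → O.P k → Prop}
    (hr : ∀ a ∈ O.δ (k+1) α, ∀ y ∈ O.δ k a, Relation.TransGen r y (O.γ k a))
    (hlt : ∀ x y, Relation.TransGen r x y → O.ltp k x y)
    {a : O.P (k+1)} (ha : a ∈ O.δ (k+1) α) {x : O.P k} (hx : x ∈ O.δ k a) :
    Relation.TransGen r x (O.γ k (O.γ (k+1) α)) := by
  induction x using (hO.wellFounded_swap_ltp k).induction generalizing a with
  | _ x ih =>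
  have hstep := hr a ha x hx
  rcases hO.γ_eq_or_mem_δ ha with heq | ⟨b, hb, hab⟩
  · rwa [← heq]
  · exact hstep.trans (ih _ (hlt _ _ hstep) hb hab)

/-- A domain face `x` of `c` is connected to `γ c` by faces that are not codomains. -/
theorem transGen_minStep_of_mem_δ {O : PreOpetope} (hO : O.IsOpetope) {k : ℕ} (c : O.P (k+1)) :
    ∀ x ∈ O.δ k c, Relation.TransGen (O.MinStep k) x (O.γ k c) := by
  induction c using (hO.wellFounded_ltp (k+1)).induction with
  | _ c ih =>
  intro x hx
  by_cases hc : ∃ α, O.γ (k+1) α = c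
  · obtain ⟨α, rfl⟩ := hc
    rw [hO.glob_δ k α] at hx
    obtain ⟨⟨a, ha, hxa⟩, -⟩ := hx
    exact hO.transGen_of_mem_δδ (fun b hb y hy => ih b (.single ⟨α, hb, rfl⟩) y hy)
      (fun _ _ => ltp_of_transGen_minStep) ha hxa
  · exact .single ⟨c, hc, hx, rfl⟩

theorem transGen_minStep_of_ltp {O : PreOpetope} (hO : O.IsOpetope)
    {k : ℕ} {a b : O.P k} (hab : O.ltp k a b) :
    Relation.TransGen (O.MinStep k) a b := by
  induction hab with
  | single hs =>
    obtain ⟨c, hc, rfl⟩ := hs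
    exact hO.transGen_minStep_of_mem_δ c _ hc
  | tail _ hs ih =>
    obtain ⟨c, hc, rfl⟩ := hs
    exact ih.trans (hO.transGen_minStep_of_mem_δ c _ hc)

theorem rightUnique_minStep {O : PreOpetope} (hO : O.IsOpetope)
    (k : ℕ) : Relator.RightUnique (O.MinStep k) := by
  rintro x y z ⟨c, hc, hxc, rfl⟩ ⟨d, hd, hxd, rfl⟩
  rcases hO.pencil_δ k x c d hxc hxd with rfl | hcd | hdc
  · rfl
  · exact (not_ltp_of_not_codomain hd hcd).elim
  · exact (not_ltp_of_not_codomain hc hdc).elim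

/-- The faces above a given face are linearly ordered by the upper order. -/
theorem ltp_total_above {O : PreOpetope} (hO : O.IsOpetope)
    {k : ℕ} {d a b : O.P k} (ha : O.ltp k d a) (hb : O.ltp k d b) :
    a = b ∨ O.ltp k a b ∨ O.ltp k b a := by
  rcases Relation.ReflTransGen.total_of_right_unique (hO.rightUnique_minStep k)
    (hO.transGen_minStep_of_ltp ha).to_reflTransGen
    (hO.transGen_minStep_of_ltp hb).to_reflTransGen with hab | hba
  · rcases Relation.reflTransGen_iff_eq_or_transGen.1 hab with heq | hlt
    · exact .inl heq.symm
    · exact .inr (.inl (ltp_of_transGen_minStep hlt))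
  · rcases Relation.reflTransGen_iff_eq_or_transGen.1 hba with heq | hlt
    · exact .inl heq
    · exact .inr (.inr (ltp_of_transGen_minStep hlt))

theorem γ_le_of_mem_δ {O : PreOpetope} (hO : O.IsOpetope)
    {k : ℕ} {α : O.P (k+2)} {a : O.P (k+1)} (ha : a ∈ O.δ (k+1) α) :
    O.γ k a = O.γ k (O.γ (k+1) α) ∨ O.ltp k (O.γ k a) (O.γ k (O.γ (k+1) α)) :=
  (hO.γ_eq_or_mem_δ ha).imp_right fun ⟨_, hb, hab⟩ =>
    hO.transGen_of_mem_δδ (fun b _ _ hy => .single ⟨b, hy, rfl⟩) (fun _ _ => id) hb hab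

theorem γ_le_of_ltp {O : PreOpetope} (hO : O.IsOpetope)
    {k : ℕ} {a b : O.P (k+1)} (hab : O.ltp (k+1) a b) :
    O.γ k a = O.γ k b ∨ O.ltp k (O.γ k a) (O.γ k b) := by
  induction hab with
  | single hs =>
    obtain ⟨α, ha, rfl⟩ := hs
    exact hO.γ_le_of_mem_δ ha
  | tail _ hs ih =>
    obtain ⟨α, ha, rfl⟩ := hs
    rcases ih with ih | ih <;> rcases hO.γ_le_of_mem_δ ha with ht | ht
    · exact .inl (ih.trans ht)
    · exact .inr (ih ▸ ht)
    · exact .inr (ht ▸ ih)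
    · exact .inr (ih.trans ht)

theorem mem_δ_or_codomain_of_ltp {O : PreOpetope} (hO : O.IsOpetope)
    {k : ℕ} {c b : O.P (k+1)} {x : O.P k} (hx : x ∈ O.δ k c)
    (hcb : O.ltp (k+1) c b) : x ∈ O.δ k b ∨ ∃ d, O.ltp (k+1) d b ∧ O.γ k d = x := by
  have hstep : ∀ (α : O.P (k+2)) (a : O.P (k+1)), a ∈ O.δ (k+1) α → x ∈ O.δ k a →
      x ∈ O.δ k (O.γ (k+1) α) ∨ ∃ d, O.ltp (k+1) d (O.γ (k+1) α) ∧ O.γ k d = x := by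
    intro α a ha hxa
    by_cases hd : ∃ d ∈ O.δ (k+1) α, O.γ k d = x
    · obtain ⟨d, hd, hdx⟩ := hd
      exact .inr ⟨d, .single ⟨α, hd, rfl⟩, hdx⟩
    · left
      rw [hO.glob_δ k α]
      exact ⟨⟨a, ha, hxa⟩, hd⟩
  induction hcb with
  | single hs =>
    obtain ⟨α, ha, rfl⟩ := hs
    exact hstep α c ha hx
  | tail _ hs ih =>
    obtain ⟨α, ha, rfl⟩ := hs
    rcases ih with hmem | ⟨d, hd, hdx⟩
    · exact hstep α _ ha hmem
    · exact .inr ⟨d, hd.tail ⟨α, ha, rfl⟩, hdx⟩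

theorem exists_le_of_transGen_minStep {O : PreOpetope} (hO : O.IsOpetope)
    {k : ℕ} {b : O.P (k+1)} {x : O.P k}
    (hx : Relation.TransGen (O.MinStep k) x (O.γ k b)) :
    ∃ c, x ∈ O.δ k c ∧ (c = b ∨ O.ltp (k+1) c b ∨ O.ltm k c b) := by
  induction hx using Relation.TransGen.head_induction_on with
  | single hs =>
    obtain ⟨c, hc, hxc, hcb⟩ := hs
    refine ⟨c, hxc, ?_⟩
    rcases hO.pencil_γ k c b hcb with heq | hlt | hgt
    · exact .inl heq
    · exact .inr (.inl hlt)
    · exact (not_ltp_of_not_codomain hc hgt).elim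
  | head hs _ ih =>
    obtain ⟨c, hc, hxc, rfl⟩ := hs
    refine ⟨c, hxc, ?_⟩
    obtain ⟨e, hce, rfl | heb | heb⟩ := ih
    · exact .inr (.inr (.single hce))
    · rcases hO.mem_δ_or_codomain_of_ltp hce heb with hmem | ⟨d, hdb, hdc⟩
      · exact .inr (.inr (.single hmem))
      · rcases hO.pencil_γ k d c hdc with rfl | hlt | hgt
        · exact .inr (.inl hdb)
        · exact (not_ltp_of_not_codomain hc hlt).elim
        · exact .inr (.inl (hgt.trans hdb))
    · exact .inr (.inr (.head hce heb))

theorem ltp_or_ltm_of_ltp_γ {O : PreOpetope} (hO : O.IsOpetope) {k : ℕ} {a b : O.P (k+1)}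
    (hab : O.ltp k (O.γ k a) (O.γ k b)) : O.ltp (k+1) a b ∨ O.ltm k a b := by
  obtain ⟨c, hac, rfl | hcb | hcb⟩ :=
    hO.exists_le_of_transGen_minStep (hO.transGen_minStep_of_ltp hab)
  · exact .inr (.single hac)
  · rcases hO.mem_δ_or_codomain_of_ltp hac hcb with hmem | ⟨d, hdb, hda⟩
    · exact .inr (.single hmem)
    · rcases hO.pencil_γ k d a hda with rfl | hlt | hgt
      · exact .inl hdb
      · rcases hO.ltp_total_above hlt hdb with rfl | hlt' | hgt'
        · exact (hO.strict k _ hab).elim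
        · exact .inl hlt'
        · rcases hO.γ_le_of_ltp hgt' with heq | hba
          · exact (hO.strict k (O.γ k a) (heq ▸ hab)).elim
          · exact (hO.strict k _ (hab.trans hba)).elim
      · exact .inl (hgt.trans hdb)
  · exact .inr (.head hac hcb)

/-- Two faces of the same dimension are equal, comparable in the upper order, or have
iterated codomains comparable in the lower order. -/
theorem trichotomy {O : PreOpetope} (hO : O.IsOpetope) : ∀ (k : ℕ) (a b : O.P k),
    a = b ∨ O.ltp k a b ∨ O.ltp k b a ∨ O.LowerComparable k a b
  | 0, a, b => by
    rcases hO.strict0 a b with heq | hlt | hgt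
    · exact .inl heq
    · exact .inr (.inl hlt)
    · exact .inr (.inr (.inl hgt))
  | (k+1), a, b => by
    rcases trichotomy hO k (O.γ k a) (O.γ k b) with heq | hlt | hgt | hlow
    · rcases hO.pencil_γ k a b heq with heq | hlt | hgt
      · exact .inl heq
      · exact .inr (.inl hlt)
      · exact .inr (.inr (.inl hgt))
    · rcases hO.ltp_or_ltm_of_ltp_γ hlt with hlt | hlt
      · exact .inr (.inl hlt)
      · exact .inr (.inr (.inr (.inl hlt)))
    · rcases hO.ltp_or_ltm_of_ltp_γ hgt with hgt | hgt
      · exact .inr (.inr (.inl hgt))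
      · exact .inr (.inr (.inr (.inr (.inl hgt))))
    · exact .inr (.inr (.inr (.inr (.inr hlow))))

theorem not_lowerComparable_of_le {O : PreOpetope} (hO : O.IsOpetope) : ∀ (k : ℕ) (a b : O.P k),
    (a = b ∨ O.ltp k a b) → ¬ O.LowerComparable k a b
  | 0, _, _, _ => id
  | (k+1), a, b, hab => by
    have hγ : O.γ k a = O.γ k b ∨ O.ltp k (O.γ k a) (O.γ k b) := by
      rcases hab with rfl | hab
      · exact .inl rfl
      · exact hO.γ_le_of_ltp hab
    rintro (hlt | hgt | hlow)
    · rcases hab with rfl | hab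
      · exact hO.not_ltm_self _ hlt
      · exact hO.disj k a b ⟨.inl hlt, .inl hab⟩
    · rcases hab with rfl | hab
      · exact hO.not_ltm_self _ hgt
      · exact hO.disj k a b ⟨.inr hgt, .inl hab⟩
    · exact not_lowerComparable_of_le hO k _ _ hγ hlow

end IsOpetope

end PreOpetope

theorem exists_eq_mk_of_fst_eq {ι : Type*} {α : ι → Type*} {s : Σ i, α i} {i : ι}
    (hs : s.1 = i) : ∃ a, s = ⟨i, a⟩ := by
  subst hs
  exact ⟨s.2, rfl⟩

namespace IsContraction

theorem map_γ_eq_γdown {Q P : PreOpetope} {h : ∀ k, Q.P k → Σ j, P.P j}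
    (hc : IsContraction Q P h) {k : ℕ} (q : Q.P (k+1)) :
    h k (Q.γ k q) = P.γdown (h (k+1) q).1 (h (k+1) q).2 k := by
  have hγ := hc.γ_pres (k+1) k q
  have hq : Q.γdown (k+1) q k = ⟨k, Q.γ k q⟩ := by
    cases k <;> simp [PreOpetope.γdown]
  rwa [hq] at hγ

theorem map_γ {Q P : PreOpetope} {h : ∀ k, Q.P k → Σ j, P.P j}
    (hc : IsContraction Q P h) {k : ℕ} {q : Q.P (k+1)} {p : P.P (k+1)} (hq : h (k+1) q = ⟨k+1, p⟩) :
    h k (Q.γ k q) = ⟨k, P.γ k p⟩ := by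
  rw [hc.map_γ_eq_γdown, hq]
  cases k <;> simp [PreOpetope.γdown]

theorem map_γ_of_drop {Q P : PreOpetope} {h : ∀ k, Q.P k → Σ j, P.P j}
    (hc : IsContraction Q P h) {k : ℕ} {q : Q.P (k+1)} (hq : (h (k+1) q).1 = k) :
    h k (Q.γ k q) = h (k+1) q := by
  rw [hc.map_γ_eq_γdown]
  generalize h (k+1) q = s at hq
  obtain ⟨j, p⟩ := s
  subst hq
  cases j <;> simp [PreOpetope.γdown]

/-- A face with a non-collapsed domain face `x` either is not collapsed itself, or has the
same image of its codomain as of `x`. -/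
theorem map_of_mem_δ {Q P : PreOpetope} {h : ∀ k, Q.P k → Σ j, P.P j}
    (hc : IsContraction Q P h) {k : ℕ} {q : Q.P (k+1)} {x : Q.P k} (hx : x ∈ Q.δ k q) {y : P.P k}
    (hxy : h k x = ⟨k, y⟩) :
    (∃ p, h (k+1) q = ⟨k+1, p⟩ ∧ y ∈ P.δ k p) ∨ h k (Q.γ k q) = ⟨k, y⟩ := by
  have hdim : (h k x).1 = k := by rw [hxy]
  rcases lt_trichotomy (h (k+1) q).1 k with hlt | heq | hgt
  · have := hc.δ_low k q hlt x hx
    omega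
  · right
    have hmem : h k x = h (k+1) q := (hc.δ_drop k q heq).mapsTo ⟨hx, hdim⟩
    rw [hc.map_γ_of_drop heq, ← hmem, hxy]
  · left
    have hfull : (h (k+1) q).1 = k+1 := le_antisymm (hc.dim_le _ q) hgt
    obtain ⟨p, hp⟩ := exists_eq_mk_of_fst_eq hfull
    obtain ⟨y', hy', hxy'⟩ := (hc.δ_eq k q p hp).mapsTo ⟨hx, hdim⟩
    obtain rfl : y = y' := eq_of_heq (Sigma.mk.inj (hxy.symm.trans hxy')).2
    exact ⟨p, hp, hy'⟩

theorem ltm_map {Q P : PreOpetope} {h : ∀ k, Q.P k → Σ j, P.P j}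
    (hc : IsContraction Q P h) {k : ℕ} {q₁ q₂ : Q.P (k+1)} {p₁ p₂ : P.P (k+1)}
    (h₁ : h (k+1) q₁ = ⟨k+1, p₁⟩) (h₂ : h (k+1) q₂ = ⟨k+1, p₂⟩) (hlt : Q.ltm k q₁ q₂) :
    P.ltm k p₁ p₂ := by
  have hpath : ∀ q, Relation.ReflTransGen (fun a b => Q.γ k a ∈ Q.δ k b) q₁ q →
      ∃ p, Relation.ReflTransGen (fun a b => P.γ k a ∈ P.δ k b) p₁ p ∧
        h k (Q.γ k q) = ⟨k, P.γ k p⟩ := by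
    intro q hq
    induction hq with
    | refl => exact ⟨p₁, .refl, hc.map_γ h₁⟩
    | tail _ hs ih =>
      obtain ⟨p, hp, hγ⟩ := ih
      rcases hc.map_of_mem_δ hs hγ with ⟨p', hp', hmem⟩ | hγ'
      · exact ⟨p', hp.tail hmem, hc.map_γ hp'⟩
      · exact ⟨p, hp, hγ'⟩
  obtain ⟨q, hq, hs⟩ := Relation.TransGen.tail'_iff.1 hlt
  obtain ⟨p, hp, hγ⟩ := hpath q hq
  have hdim : (h k (Q.γ k q)).1 = k := by rw [hγ]
  obtain ⟨y, hy, hγy⟩ := (hc.δ_eq k q₂ p₂ h₂).mapsTo ⟨hs, hdim⟩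
  obtain rfl : P.γ k p = y := eq_of_heq (Sigma.mk.inj (hγ.symm.trans hγy)).2
  exact Relation.TransGen.tail' hp hy

theorem le_map_of_ltp {Q P : PreOpetope} {h : ∀ k, Q.P k → Σ j, P.P j}
    (hc : IsContraction Q P h) {k : ℕ} {q₁ q₂ : Q.P k} {p₁ p₂ : P.P k}
    (h₁ : h k q₁ = ⟨k, p₁⟩) (h₂ : h k q₂ = ⟨k, p₂⟩) (hlt : Q.ltp k q₁ q₂) :
    p₁ = p₂ ∨ P.ltp k p₁ p₂ := by
  have hpath : ∃ p, h k q₂ = ⟨k, p⟩ ∧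
      Relation.ReflTransGen (fun a b => ∃ c : P.P (k+1), a ∈ P.δ k c ∧ P.γ k c = b) p₁ p := by
    clear h₂
    replace hlt := hlt.to_reflTransGen
    induction hlt with
    | refl => exact ⟨p₁, h₁, .refl⟩
    | tail _ hs ih =>
      obtain ⟨α, ha, rfl⟩ := hs
      obtain ⟨p, hp, hle⟩ := ih
      rcases hc.map_of_mem_δ ha hp with ⟨β, hβ, hmem⟩ | hγ
      · exact ⟨P.γ k β, hc.map_γ hβ, hle.tail ⟨β, hmem, rfl⟩⟩
      · exact ⟨p, hγ, hle⟩
  obtain ⟨p, hp, hle⟩ := hpath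
  obtain rfl : p₂ = p := eq_of_heq (Sigma.mk.inj (h₂.symm.trans hp)).2
  rcases Relation.reflTransGen_iff_eq_or_transGen.1 hle with heq | hlt
  · exact .inl heq.symm
  · exact .inr hlt

theorem lowerComparable_map {Q P : PreOpetope} {h : ∀ k, Q.P k → Σ j, P.P j}
    (hc : IsContraction Q P h) : ∀ {k : ℕ} {q₁ q₂ : Q.P k} {p₁ p₂ : P.P k},
    h k q₁ = ⟨k, p₁⟩ → h k q₂ = ⟨k, p₂⟩ → Q.LowerComparable k q₁ q₂ →
      P.LowerComparable k p₁ p₂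
  | (_+1), _, _, _, _, h₁, h₂, .inl hlt => .inl (hc.ltm_map h₁ h₂ hlt)
  | (_+1), _, _, _, _, h₁, h₂, .inr (.inl hgt) => .inr (.inl (hc.ltm_map h₂ h₁ hgt))
  | (_+1), _, _, _, _, h₁, h₂, .inr (.inr hlow) =>
    .inr (.inr (lowerComparable_map hc (hc.map_γ h₁) (hc.map_γ h₂) hlow))

theorem ltm_of_ltm_map {Q P : PreOpetope} {h : ∀ k, Q.P k → Σ j, P.P j}
    (hc : IsContraction Q P h) (hQ : Q.IsOpetope) (hP : P.IsOpetope) {k : ℕ} {q₁ q₂ : Q.P (k+1)}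
    {p₁ p₂ : P.P (k+1)} (h₁ : h (k+1) q₁ = ⟨k+1, p₁⟩) (h₂ : h (k+1) q₂ = ⟨k+1, p₂⟩)
    (hlt : P.ltm k p₁ p₂) : Q.ltm k q₁ q₂ := by
  rcases hQ.trichotomy (k+1) q₁ q₂ with rfl | hq | hq | hq | hq | hq
  · obtain rfl : p₁ = p₂ := eq_of_heq (Sigma.mk.inj (h₁.symm.trans h₂)).2
    exact (hP.not_ltm_self _ hlt).elim
  · exact (hP.not_lowerComparable_of_le _ _ _ (hc.le_map_of_ltp h₁ h₂ hq) (.inl hlt)).elim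
  · exact (hP.not_lowerComparable_of_le _ _ _ (hc.le_map_of_ltp h₂ h₁ hq)
      (.inr (.inl hlt))).elim
  · exact hq
  · exact (hP.not_ltm_self _ (hlt.trans (hc.ltm_map h₂ h₁ hq))).elim
  · exact (hP.not_lowerComparable_of_le k _ _ (.inr (PreOpetope.ltp_γ_of_ltm hlt))
      (hc.lowerComparable_map (hc.map_γ h₁) (hc.map_γ h₂) hq)).elim

end IsContraction

/-- Let `h : Q → P` be a contraction morphism of positive opetopes and
`q₁, q₂ ∈ Q − ker(h)`.  Then `q₁ <⁻ q₂` iff `h(q₁) <⁻ h(q₂)`. -/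
theorem stmt_15 (Q P : PreOpetope) (hQ : Q.IsOpetope) (hP : P.IsOpetope)
    (h : ∀ k, Q.P k → Σ j, P.P j) (hc : IsContraction Q P h)
    (k : ℕ) (q₁ q₂ : Q.P (k+1))
    (h₁ : (h (k+1) q₁).1 = k+1) (h₂ : (h (k+1) q₂).1 = k+1) :
    Q.ltm k q₁ q₂ ↔
      ∃ (p₁ p₂ : P.P (k+1)), h (k+1) q₁ = ⟨k+1, p₁⟩ ∧ h (k+1) q₂ = ⟨k+1, p₂⟩ ∧
        P.ltm k p₁ p₂ := by
  obtain ⟨p₁, hp₁⟩ := exists_eq_mk_of_fst_eq h₁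
  obtain ⟨p₂, hp₂⟩ := exists_eq_mk_of_fst_eq h₂
  refine ⟨fun hlt => ⟨p₁, p₂, hp₁, hp₂, hc.ltm_map hp₁ hp₂ hlt⟩, ?_⟩
  rintro ⟨p₁', p₂', hp₁', hp₂', hlt⟩
  exact hc.ltm_of_ltm_map hQ hP hp₁' hp₂' hlt
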